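/- Let S be a compact Hausdorff extremally disconnected space with no isolated points, G a countably infinite group, and ε : G → Homeo(S) an injective action of G on S by homeomorphisms such that for some s₀ ∈ S the orbit D = {ε_g(s₀) : g ∈ G} is dense in S and the action is pseudo-free on D. Then there exist a homeomorphism φ : S → S and a dense Gδ subset S₀ ⊆ S such that: S₀ is invariant under the action of G; φ[S₀] = S₀; and on S₀ the orbit equivalence relation coming from G coincides with the ℤ-orbit equivalence relation coming from φ (i.e., for x, y ∈ S₀, y = ε_g(x) for some g ∈ G if and only if y = φʲ(x) for some j ∈ ℤ). -/

import Mathlib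

/-- `A` is a clopen subset of `Z` in the relative topology of `Z`. -/
def RelClopen {S : Type*} [TopologicalSpace S] (Z A : Set S) : Prop :=
  A ⊆ Z ∧ IsClopen ((Subtype.val ⁻¹' A) : Set Z)

open Set Filter Topology Relation

section LocallyIn

variable {S : Type*} [TopologicalSpace S]

/-- Near `x`, the map `f` agrees with an element of the group `Γ`. -/
def LocallyIn (Γ : Subgroup (S ≃ₜ S)) (f : S → S) (x : S) : Prop :=
  ∃ γ ∈ Γ, f =ᶠ[𝓝 x] γ

variable {Γ : Subgroup (S ≃ₜ S)}

theorem LocallyIn.continuousAt {f : S → S} {x : S} (h : LocallyIn Γ f x) : ContinuousAt f x := by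
  obtain ⟨γ, -, h⟩ := h
  exact γ.continuous.continuousAt.congr h.symm

theorem LocallyIn.congr {f g : S → S} {x : S} (h : LocallyIn Γ f x) (hfg : g =ᶠ[𝓝 x] f) :
    LocallyIn Γ g x := by
  obtain ⟨γ, hγ, h⟩ := h
  exact ⟨γ, hγ, hfg.trans h⟩

theorem LocallyIn.apply_mem {f : S → S} {x : S} (h : LocallyIn Γ f x) {D : Set S}
    (hD : ∀ γ ∈ Γ, ∀ x ∈ D, γ x ∈ D) (hx : x ∈ D) : f x ∈ D := by
  obtain ⟨γ, hγ, h⟩ := h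
  rw [h.eq_of_nhds]
  exact hD γ hγ x hx

theorem LocallyIn.of_apply_mem {f : S → S} {x : S} (h : LocallyIn Γ f x) {D : Set S}
    (hD : ∀ γ ∈ Γ, ∀ x ∈ D, γ x ∈ D) (hx : f x ∈ D) : x ∈ D := by
  obtain ⟨γ, hγ, h⟩ := h
  rw [h.eq_of_nhds] at hx
  simpa using hD γ⁻¹ (Γ.inv_mem hγ) _ hx

theorem LocallyIn.comp {f g : S → S} {x : S} (hg : LocallyIn Γ g (f x)) (hf : LocallyIn Γ f x) :
    LocallyIn Γ (g ∘ f) x := by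
  have hc := hf.continuousAt
  obtain ⟨γ, hγ, hf⟩ := hf
  obtain ⟨δ, hδ, hg⟩ := hg
  refine ⟨δ * γ, Γ.mul_mem hδ hγ, ?_⟩
  filter_upwards [hf, hc.eventually hg] with y hy hy'
  simp only [Function.comp_apply, Homeomorph.mul_apply]
  rw [hy', hy]

theorem LocallyIn.symm {ψ : S ≃ₜ S} {x : S} (h : LocallyIn Γ ψ x) :
    LocallyIn Γ (ψ⁻¹ : S ≃ₜ S) (ψ x) := by
  obtain ⟨γ, hγ, h⟩ := h
  refine ⟨γ⁻¹, Γ.inv_mem hγ, ?_⟩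
  have hc : Tendsto γ.symm (𝓝 (ψ x)) (𝓝 x) := by
    have := γ.symm.continuous.tendsto (ψ x)
    rwa [h.eq_of_nhds, γ.symm_apply_apply, ← h.eq_of_nhds] at this
  filter_upwards [hc.eventually h] with y hy
  rw [γ.apply_symm_apply] at hy
  simpa using congrArg ψ.symm hy.symm

theorem isOpen_setOf_locallyIn (f : S → S) : IsOpen {x | LocallyIn Γ f x} := by
  rw [isOpen_iff_mem_nhds]
  rintro x ⟨γ, hγ, h⟩
  filter_upwards [h.eventually_nhds] with y hy
  exact ⟨γ, hγ, hy⟩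

theorem isOpen_image_of_locallyIn {f : S → S} {U : Set S} (hU : IsOpen U)
    (hf : ∀ x ∈ U, LocallyIn Γ f x) : IsOpen (f '' U) := by
  rw [isOpen_iff_mem_nhds]
  rintro _ ⟨x, hx, rfl⟩
  obtain ⟨γ, hγ, h⟩ := hf x hx
  have := γ.isOpenMap.image_mem_nhds (inter_mem (hU.mem_nhds hx) h)
  rw [← h.eq_of_nhds] at this
  filter_upwards [this]
  rintro _ ⟨y, ⟨hy, hfy⟩, rfl⟩
  exact ⟨y, hy, hfy⟩

theorem locallyIn_of_leftInvOn {f g : S → S} {U : Set S} (hU : IsOpen U) (hg : LeftInvOn g f U)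
    {x : S} (hx : x ∈ U) (hf : LocallyIn Γ f x) : LocallyIn Γ g (f x) := by
  obtain ⟨γ, hγ, h⟩ := hf
  refine ⟨γ⁻¹, Γ.inv_mem hγ, ?_⟩
  have hc : Tendsto γ.symm (𝓝 (f x)) (𝓝 x) := by
    have := γ.symm.continuous.tendsto (f x)
    rwa [h.eq_of_nhds, γ.symm_apply_apply, ← h.eq_of_nhds] at this
  filter_upwards [hc.eventually h, hc.eventually (hU.mem_nhds hx)] with y hy hyU
  rw [γ.apply_symm_apply] at hy
  simpa [hy] using hg hyU

end LocallyIn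

/-- A continuous map from a dense open subset of an extremally disconnected compact Hausdorff space
to a compact Hausdorff space extends continuously. -/
theorem exists_continuous_extension {S : Type*} [TopologicalSpace S] [CompactSpace S] [T2Space S]
    [ExtremallyDisconnected S] {U : Set S} (hU : IsOpen U) (hd : Dense U) {f : S → S}
    (hf : ContinuousOn f U) : ∃ F : S → S, Continuous F ∧ EqOn F f U := by
  let C : Set (S × S) := closure ((fun x => (x, f x)) '' U)
  have : CompactSpace C := isCompact_iff_compactSpace.1 isClosed_closure.isCompact
  have hp : Continuous (fun c : C => c.1.1) := continuous_fst.comp continuous_subtype_val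
  have hsurj : Function.Surjective (fun c : C => c.1.1) := by
    rw [← range_eq_univ, ← (isCompact_range hp).isClosed.closure_eq, ← univ_subset_iff,
      ← hd.closure_eq]
    exact closure_mono fun x hx => ⟨⟨(x, f x), subset_closure ⟨x, hx, rfl⟩⟩, rfl⟩
  obtain ⟨s, hs, hps⟩ := CompactT2.ExtremallyDisconnected.projective continuous_id hp hsurj
  refine ⟨fun x => (s x).1.2, continuous_snd.comp (continuous_subtype_val.comp hs), fun x hx => ?_⟩
  have hsx : (s x).1.1 = x := congrFun hps x
  by_contra hne
  obtain ⟨u, v, hu, hv, hxu, hxv, huv⟩ := t2_separation hne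
  have hmem : U ∩ f ⁻¹' v ∈ 𝓝 x :=
    inter_mem (hU.mem_nhds hx) ((hf.continuousAt (hU.mem_nhds hx)) (hv.mem_nhds hxv))
  have hn : (U ∩ f ⁻¹' v) ×ˢ u ∈ 𝓝 (s x).1 := by
    rw [nhds_prod_eq, hsx]
    exact prod_mem_prod hmem (hu.mem_nhds hxu)
  obtain ⟨_, hy, y, -, rfl⟩ := mem_closure_iff_nhds.1 (s x).2 _ hn
  exact huv.le_bot ⟨hy.2, hy.1.2⟩

/-- A locally-`Γ` partial homeomorphism with dense open domain and dense range extends to a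
homeomorphism of an extremally disconnected compact Hausdorff space. -/
theorem exists_homeomorph_extension {S : Type*} [TopologicalSpace S] [CompactSpace S] [T2Space S]
    [ExtremallyDisconnected S] {Γ : Subgroup (S ≃ₜ S)} {U : Set S} (hU : IsOpen U) (hd : Dense U)
    {f : S → S} (hf : ∀ x ∈ U, LocallyIn Γ f x) (hinj : InjOn f U) (hd' : Dense (f '' U)) :
    ∃ φ : S ≃ₜ S, EqOn φ f U := by
  obtain _ | _ := isEmpty_or_nonempty S
  · exact ⟨Homeomorph.refl S, fun x => isEmptyElim x⟩
  have hg : LeftInvOn (Function.invFunOn f U) f U := hinj.leftInvOn_invFunOn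
  obtain ⟨F, hF, hFf⟩ := exists_continuous_extension hU hd
    (fun x hx => (hf x hx).continuousAt.continuousWithinAt)
  obtain ⟨H, hH, hHg⟩ := exists_continuous_extension (f := Function.invFunOn f U)
    (isOpen_image_of_locallyIn hU hf) hd' (by
      rintro _ ⟨x, hx, rfl⟩
      exact (locallyIn_of_leftInvOn hU hg hx (hf x hx)).continuousAt.continuousWithinAt)
  have h1 : H ∘ F = id := (hH.comp hF).ext_on hd continuous_id fun x hx => by
    rw [Function.comp_apply, hFf hx, hHg (mem_image_of_mem f hx), hg hx, id]
  have h2 : F ∘ H = id := (hF.comp hH).ext_on hd' continuous_id (by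
    rintro _ ⟨x, hx, rfl⟩
    rw [Function.comp_apply, hHg (mem_image_of_mem f hx), hg hx, hFf hx, id])
  exact ⟨⟨⟨F, H, congrFun h1, congrFun h2⟩, hF, hH⟩, hFf⟩

/-- A homeomorphism between clopen sets, locally in `Γ`, all of whose forward and backward orbits
leave the domain (respectively the range) after finitely many steps; `top x` is the last point of
the forward orbit of `x`. -/
structure PartialTranslation {S : Type*} [TopologicalSpace S] (Γ : Subgroup (S ≃ₜ S)) where
  dom : Set S
  map : S → S
  top : S → S
  isClopen_dom : IsClopen dom
  locallyIn_map : ∀ x ∈ dom, LocallyIn Γ map x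
  injOn_map : InjOn map dom
  continuous_top : Continuous top
  top_notMem : ∀ x, top x ∉ dom
  top_map : ∀ x ∈ dom, top (map x) = top x
  reaches_top : ∀ x, ReflTransGen (fun a b => a ∈ dom ∧ map a = b) x (top x)
  exists_bottom : ∀ x, ∃ e, e ∉ map '' dom ∧ ReflTransGen (fun a b => a ∈ dom ∧ map a = b) e x

namespace PartialTranslation

variable {S : Type*} [TopologicalSpace S] {Γ : Subgroup (S ≃ₜ S)}

instance : Preorder (PartialTranslation Γ) where
  le P Q := P.dom ⊆ Q.dom ∧ EqOn Q.map P.map P.dom ∧ ∀ x y, P.top x = P.top y → Q.top x = Q.top y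
  le_refl P := ⟨Subset.rfl, fun _ _ => rfl, fun _ _ h => h⟩
  le_trans P Q R h h' := ⟨h.1.trans h'.1, fun x hx => (h'.2.1 (h.1 hx)).trans (h.2.1 hx),
    fun x y hxy => h'.2.2 x y (h.2.2 x y hxy)⟩

/-- The partial translation with empty domain. -/
def empty (Γ : Subgroup (S ≃ₜ S)) : PartialTranslation Γ where
  dom := ∅
  map := id
  top := id
  isClopen_dom := isClopen_empty
  locallyIn_map := by simp
  injOn_map := by simp
  continuous_top := continuous_id
  top_notMem := by simp
  top_map := by simp
  reaches_top x := ReflTransGen.refl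
  exists_bottom x := ⟨x, by simp, ReflTransGen.refl⟩

variable (P : PartialTranslation Γ)

theorem top_eq_of_reaches {x y : S} (h : ReflTransGen (fun a b => a ∈ P.dom ∧ P.map a = b) x y) :
    P.top x = P.top y := by
  induction h with
  | refl => rfl
  | tail _ h ih => rw [ih, ← h.2, P.top_map _ h.1]

theorem top_eq_self {x : S} (hx : x ∉ P.dom) : P.top x = x := by
  obtain h | ⟨y, h, -⟩ := (P.reaches_top x).cases_head
  · exact h.symm
  · exact absurd h.1 hx

theorem mem_iff_of_reaches {D : Set S} (hD : ∀ γ ∈ Γ, ∀ x ∈ D, γ x ∈ D) {x y : S}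
    (h : ReflTransGen (fun a b => a ∈ P.dom ∧ P.map a = b) x y) : x ∈ D ↔ y ∈ D := by
  induction h with
  | refl => rfl
  | tail _ h ih =>
    rw [ih, ← h.2]
    exact ⟨(P.locallyIn_map _ h.1).apply_mem hD, (P.locallyIn_map _ h.1).of_apply_mem hD⟩

theorem isClosed_image [CompactSpace S] [T2Space S] : IsClosed (P.map '' P.dom) :=
  (P.isClopen_dom.isClosed.isCompact.image_of_continuousOn
    fun x hx => (P.locallyIn_map x hx).continuousAt.continuousWithinAt).isClosed

/-- Extend a partial translation by an element `γ` of `Γ` on a clopen set `O` of top points. -/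
theorem exists_glue {O : Set S} (hO : IsClopen O) {γ : S ≃ₜ S} (hγ : γ ∈ Γ)
    (hOd : ∀ x ∈ O, x ∉ P.dom) (hOi : ∀ x ∈ O, γ x ∉ P.map '' P.dom)
    (hOt : ∀ x ∈ O, P.top (γ x) ∉ O) :
    ∃ Q : PartialTranslation Γ, P ≤ Q ∧ O ⊆ Q.dom ∧
      ∀ x, (P.top x ∈ O → Q.top x = P.top (γ (P.top x))) ∧ (P.top x ∉ O → Q.top x = P.top x) := by
  classical
  set F : S → S := O.piecewise γ P.map
  set T : S → S := fun x => if P.top x ∈ O then P.top (γ (P.top x)) else P.top x with hT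
  have hFO : ∀ x ∈ O, F x = γ x := fun x hx => piecewise_eq_of_mem _ _ _ hx
  have hFd : ∀ x ∈ P.dom, F x = P.map x := fun x hx =>
    piecewise_eq_of_notMem _ _ _ fun h => hOd x h hx
  have hlift : ∀ {x y}, ReflTransGen (fun a b => a ∈ P.dom ∧ P.map a = b) x y →
      ReflTransGen (fun a b => a ∈ P.dom ∪ O ∧ F a = b) x y := fun h =>
    ReflTransGen.mono (fun a b hab => ⟨Or.inl hab.1, (hFd a hab.1).trans hab.2⟩) _ _ h
  have hTO : ∀ x, P.top x ∈ O → T x = P.top (γ (P.top x)) := fun x hx => if_pos hx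
  have hTn : ∀ x, P.top x ∉ O → T x = P.top x := fun x hx => if_neg hx
  have himg : ∀ e, e ∉ P.map '' P.dom → (∀ y ∈ O, γ y ≠ e) → e ∉ F '' (P.dom ∪ O) := by
    rintro e he heO ⟨y, hy | hy, rfl⟩
    · exact he ⟨y, hy, (hFd y hy).symm⟩
    · exact heO y hy (hFO y hy).symm
  refine ⟨{ dom := P.dom ∪ O, map := F, top := T, isClopen_dom := P.isClopen_dom.union hO,
            locallyIn_map := ?_, injOn_map := ?_, continuous_top := ?_, top_notMem := ?_,
            top_map := ?_, reaches_top := ?_, exists_bottom := ?_ }, ⟨subset_union_left, hFd, ?_⟩,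
          subset_union_right, fun x => ⟨hTO x, hTn x⟩⟩
  · rintro x (hx | hx)
    · exact (P.locallyIn_map x hx).congr
        (mem_of_superset (P.isClopen_dom.isOpen.mem_nhds hx) hFd)
    · exact ⟨γ, hγ, mem_of_superset (hO.isOpen.mem_nhds hx) hFO⟩
  · rintro x (hx | hx) y (hy | hy) hxy
    · rw [hFd x hx, hFd y hy] at hxy
      exact P.injOn_map hx hy hxy
    · rw [hFd x hx, hFO y hy] at hxy
      exact absurd ⟨x, hx, hxy⟩ (hOi y hy)
    · rw [hFO x hx, hFd y hy] at hxy
      exact absurd ⟨y, hy, hxy.symm⟩ (hOi x hx)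
    · rw [hFO x hx, hFO y hy] at hxy
      exact γ.injective hxy
  · refine continuous_if (fun x hx => ?_)
      (P.continuous_top.comp (γ.continuous.comp P.continuous_top)).continuousOn
      P.continuous_top.continuousOn
    have : frontier {x | P.top x ∈ O} = ∅ := (hO.preimage P.continuous_top).frontier_eq
    simp [this] at hx
  · rintro x (hx | hx) <;> by_cases h : P.top x ∈ O
    · exact P.top_notMem _ (hTO x h ▸ hx)
    · exact P.top_notMem _ (hTn x h ▸ hx)
    · exact hOt _ h (hTO x h ▸ hx)
    · exact h (hTn x h ▸ hx)
  · rintro x (hx | hx)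
    · rw [hFd x hx]
      simp only [hT, P.top_map x hx]
    · have hx' := P.top_eq_self (hOd x hx)
      rw [hFO x hx, hTn _ (hOt x hx), hTO x (by rwa [hx']), hx']
  · intro x
    by_cases h : P.top x ∈ O
    · rw [hTO x h]
      exact ((hlift (P.reaches_top x)).tail ⟨Or.inr h, hFO _ h⟩).trans (hlift (P.reaches_top _))
    · rw [hTn x h]
      exact hlift (P.reaches_top x)
  · intro x
    obtain ⟨e, he, hex⟩ := P.exists_bottom x
    by_cases h : ∃ y ∈ O, γ y = e
    · obtain ⟨y, hy, rfl⟩ := h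
      obtain ⟨e', he', hey⟩ := P.exists_bottom y
      refine ⟨e', himg e' he' ?_, ((hlift hey).tail ⟨Or.inr hy, hFO y hy⟩).trans (hlift hex)⟩
      rintro z hz rfl
      apply hOt z hz
      rwa [P.top_eq_of_reaches hey, P.top_eq_self (hOd y hy)]
    · push Not at h
      exact ⟨e, himg e he h, hlift hex⟩
  · intro x y hxy
    simp only [hT, hxy]

variable {D : Set S} [CompactSpace S] [T2Space S] [TotallyDisconnectedSpace S]

/-- Two orbit segments through points of the same `Γ`-orbit can be joined, mapping the end of the
first to the start of the second. -/
theorem exists_merge (hD : ∀ γ ∈ Γ, ∀ x ∈ D, γ x ∈ D) (htrans : ∀ x ∈ D, ∀ y ∈ D, ∃ γ ∈ Γ, γ x = y)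
    {x y : S} (hx : x ∈ D) (hy : y ∈ D) (hxy : P.top x ≠ P.top y) :
    ∃ Q : PartialTranslation Γ, P ≤ Q ∧ P.top x ∈ Q.dom ∧ Q.top x = Q.top y := by
  obtain ⟨e, he, hey⟩ := P.exists_bottom y
  obtain ⟨γ, hγ, hte⟩ := htrans _ ((P.mem_iff_of_reaches hD (P.reaches_top x)).1 hx) e
    ((P.mem_iff_of_reaches hD hey).2 hy)
  have hety := P.top_eq_of_reaches hey
  have hH : Continuous fun z => P.top (γ z) := P.continuous_top.comp γ.continuous
  obtain ⟨u, v, hu, hv, hxu, hyv, huv⟩ := t2_separation hxy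
  obtain ⟨O, hO, htO, hOsub⟩ := compact_exists_isClopen_in_isOpen (x := P.top x)
    (U := u ∩ (fun z => P.top (γ z)) ⁻¹' v ∩ P.domᶜ ∩ γ ⁻¹' (P.map '' P.dom)ᶜ)
    (((hu.inter (hv.preimage hH)).inter P.isClopen_dom.compl.isOpen).inter
      (P.isClosed_image.isOpen_compl.preimage γ.continuous))
    ⟨⟨⟨hxu, by simpa [hte, hety] using hyv⟩, P.top_notMem x⟩, by simpa [hte] using he⟩
  obtain ⟨Q, hPQ, hOQ, hQ⟩ := P.exists_glue hO hγ (fun z hz => (hOsub hz).1.2)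
    (fun z hz => (hOsub hz).2)
    (fun z hz h => huv.le_bot ⟨(hOsub h).1.1.1, (hOsub hz).1.1.2⟩)
  refine ⟨Q, hPQ, hOQ htO, ?_⟩
  rw [(hQ x).1 htO, (hQ y).2 fun h => huv.le_bot ⟨(hOsub h).1.1.1, hyv⟩, hte, hety]

theorem exists_extension (hD : ∀ γ ∈ Γ, ∀ x ∈ D, γ x ∈ D)
    (htrans : ∀ x ∈ D, ∀ y ∈ D, ∃ γ ∈ Γ, γ x = y) (hdense : Dense D)
    (hiso : ∀ x : S, ¬ IsOpen ({x} : Set S)) {x y : S} (hx : x ∈ D) (hy : y ∈ D) :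
    ∃ Q : PartialTranslation Γ, P ≤ Q ∧ y ∈ Q.dom ∧ Q.top x = Q.top y := by
  obtain ⟨Q, hPQ, hQ⟩ : ∃ Q : PartialTranslation Γ, P ≤ Q ∧ Q.top x = Q.top y := by
    by_cases h : P.top x = P.top y
    · exact ⟨P, le_rfl, h⟩
    · obtain ⟨Q, h1, -, h2⟩ := P.exists_merge hD htrans hx hy h
      exact ⟨Q, h1, h2⟩
  obtain ⟨z, hz, hxz⟩ : ∃ z ∈ D, Q.top x ≠ Q.top z := by
    by_contra! h
    have hconst : Q.top = fun _ => Q.top x :=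
      Q.continuous_top.ext_on hdense continuous_const fun z hz => (h z hz).symm
    apply hiso (Q.top x)
    convert Q.isClopen_dom.compl.isOpen using 1
    ext z
    refine ⟨fun hz => ?_, fun hz => ?_⟩
    · rw [mem_singleton_iff.1 hz]
      exact Q.top_notMem x
    · rw [← Q.top_eq_self hz, hconst]
      rfl
  obtain ⟨R, hQR, hR, -⟩ := Q.exists_merge hD htrans hx hz hxz
  refine ⟨R, hPQ.trans hQR, ?_, hQR.2.2 _ _ hQ⟩
  by_cases hyQ : y ∈ Q.dom
  · exact hQR.1 hyQ
  · rwa [hQ, Q.top_eq_self hyQ] at hR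

end PartialTranslation

theorem reaches_linked_of_injOn {S : Type*} {f : S → S} {U : Set S} (hf : InjOn f U) {x y z : S}
    (hx : ReflTransGen (fun a b => a ∈ U ∧ f a = b) x z)
    (hy : ReflTransGen (fun a b => a ∈ U ∧ f a = b) y z) :
    ReflTransGen (fun a b => a ∈ U ∧ f a = b) x y ∨
      ReflTransGen (fun a b => a ∈ U ∧ f a = b) y x := by
  have key : Relator.RightUnique (Function.swap fun a b => a ∈ U ∧ f a = b) :=
    fun a b c hb hc => hf hb.1 hc.1 (hb.2.trans hc.2.symm)
  obtain h | h := ReflTransGen.total_of_right_unique key hx.swap hy.swap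
  · exact Or.inr h.swap
  · exact Or.inl h.swap

section Generic

variable {S : Type*} [TopologicalSpace S] {Γ : Subgroup (S ≃ₜ S)}

theorem exists_zpow_of_reaches {φ : S ≃ₜ S} {U : Set S} (hU : ∀ x ∈ U, LocallyIn Γ φ x) {x y : S}
    (h : ReflTransGen (fun a b => a ∈ U ∧ φ a = b) x y) :
    ∃ ψ ∈ Subgroup.zpowers φ, ψ x = y ∧ LocallyIn Γ ψ x := by
  induction h with
  | refl => exact ⟨1, one_mem _, rfl, 1, one_mem _, EventuallyEq.rfl⟩
  | tail _ h ih =>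
    obtain ⟨ψ, hψ, rfl, hl⟩ := ih
    exact ⟨φ * ψ, mul_mem (Subgroup.mem_zpowers φ) hψ, h.2, (hU _ h.1).comp hl⟩

/-- A group acting with a countable dense orbit `D` admits a homeomorphism that is locally in the
group on `D` and has `D` inside a single orbit. -/
theorem exists_homeomorph_orbit [CompactSpace S] [T2Space S] [ExtremallyDisconnected S]
    (hiso : ∀ x : S, ¬ IsOpen ({x} : Set S)) {D : Set S} (hD : ∀ γ ∈ Γ, ∀ x ∈ D, γ x ∈ D)
    (htrans : ∀ x ∈ D, ∀ y ∈ D, ∃ γ ∈ Γ, γ x = y) (hdense : Dense D) {d : ℕ → S}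
    (hd : range d = D) :
    ∃ φ : S ≃ₜ S, (∀ x ∈ D, LocallyIn Γ φ x) ∧
      ∀ x ∈ D, ∀ y ∈ D, ∃ ψ ∈ Subgroup.zpowers φ, ψ x = y ∧ LocallyIn Γ ψ x := by
  have hdD : ∀ n, d n ∈ D := fun n => hd ▸ mem_range_self n
  choose next hle hdom htop using fun (P : PartialTranslation Γ) (n : ℕ) =>
    P.exists_extension hD htrans hdense hiso (hdD 0) (hdD n)
  obtain ⟨P, hP⟩ : ∃ P : ℕ → PartialTranslation Γ, ∀ n, P (n + 1) = next (P n) n :=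
    ⟨fun n => Nat.rec (PartialTranslation.empty Γ) (fun n Q => next Q n) n, fun _ => rfl⟩
  have hmono : Monotone P := monotone_nat_of_le_succ fun n => hP n ▸ hle (P n) n
  have htopP : ∀ n m, n < m → (P m).top (d 0) = (P m).top (d n) := fun n m h =>
    (hmono (Nat.succ_le_of_lt h)).2.2 _ _ (hP n ▸ htop (P n) n)
  let U : Set S := ⋃ n, (P n).dom
  have hUo : IsOpen U := isOpen_iUnion fun n => (P n).isClopen_dom.isOpen
  have hDU : D ⊆ U := by
    rw [← hd]
    rintro _ ⟨n, rfl⟩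
    exact mem_iUnion.2 ⟨n + 1, hP n ▸ hdom (P n) n⟩
  obtain ⟨f, hf⟩ : ∃ f : S → S, ∀ n, EqOn f (P n).map (P n).dom := by
    have : ∀ x, ∃ y, ∀ n, x ∈ (P n).dom → y = (P n).map x := by
      intro x
      by_cases h : ∃ n, x ∈ (P n).dom
      · obtain ⟨n, hn⟩ := h
        refine ⟨(P n).map x, fun m hm => ?_⟩
        obtain h | h := le_total n m
        · exact ((hmono h).2.1 hn).symm
        · exact (hmono h).2.1 hm
      · exact ⟨x, fun n hn => absurd ⟨n, hn⟩ h⟩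
    choose f hf using this
    exact ⟨f, fun n x hx => hf x n hx⟩
  have hloc : ∀ x ∈ U, LocallyIn Γ f x := by
    intro x hx
    obtain ⟨n, hn⟩ := mem_iUnion.1 hx
    exact ((P n).locallyIn_map x hn).congr
      (mem_of_superset ((P n).isClopen_dom.isOpen.mem_nhds hn) (hf n))
  have hinj : InjOn f U := by
    intro x hx y hy hxy
    obtain ⟨n, hn⟩ := mem_iUnion.1 hx
    obtain ⟨m, hm⟩ := mem_iUnion.1 hy
    have hn' := (hmono (le_max_left n m)).1 hn
    have hm' := (hmono (le_max_right n m)).1 hm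
    rw [hf _ hn', hf _ hm'] at hxy
    exact (P _).injOn_map hn' hm' hxy
  have hmeet : ∀ x ∈ D, ∀ y ∈ D, ∃ z, ReflTransGen (fun a b => a ∈ U ∧ f a = b) x z ∧
      ReflTransGen (fun a b => a ∈ U ∧ f a = b) y z := by
    rw [← hd]
    rintro _ ⟨n, rfl⟩ _ ⟨m, rfl⟩
    have key : ∀ x, ReflTransGen (fun a b => a ∈ U ∧ f a = b) x ((P (max n m + 1)).top x) :=
      fun x => ReflTransGen.mono
        (fun a b hab => ⟨mem_iUnion.2 ⟨_, hab.1⟩, (hf _ hab.1).trans hab.2⟩)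
        _ _ ((P (max n m + 1)).reaches_top x)
    refine ⟨_, key (d n), ?_⟩
    rw [← htopP n _ (by omega), htopP m _ (by omega)]
    exact key (d m)
  have himg : Dense (f '' U) := by
    by_cases h : D ⊆ f '' U
    · exact hdense.mono h
    · obtain ⟨a, haD, ha⟩ := not_subset.1 h
      have : (𝓝[≠] a).NeBot :=
        ⟨fun h => hiso a ((isOpen_singleton_iff_punctured_nhds a).2 h)⟩
      refine (hdense.sdiff_singleton a).mono fun b hb => ?_
      by_contra hbU
      have hend : ∀ {u v}, ReflTransGen (fun a b => a ∈ U ∧ f a = b) u v → v ∉ f '' U → u = v := by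
        intro u v huv hv
        obtain h | ⟨w, -, h⟩ := huv.cases_tail
        · exact h.symm
        · exact absurd ⟨w, h⟩ hv
      obtain ⟨z, haz, hbz⟩ := hmeet a haD b hb.1
      obtain h | h := reaches_linked_of_injOn hinj haz hbz
      · exact hb.2 (hend h hbU).symm
      · exact hb.2 (hend h ha)
  obtain ⟨φ, hφ⟩ := exists_homeomorph_extension hUo (hdense.mono hDU) hloc hinj himg
  have hlocφ : ∀ x ∈ U, LocallyIn Γ φ x := fun x hx =>
    (hloc x hx).congr (mem_of_superset (hUo.mem_nhds hx) hφ)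
  refine ⟨φ, fun x hx => hlocφ x (hDU hx), fun x hx y hy => ?_⟩
  obtain ⟨z, hxz, hyz⟩ := hmeet x hx y hy
  have key : ∀ {x}, ReflTransGen (fun a b => a ∈ U ∧ f a = b) x z →
      ReflTransGen (fun a b => a ∈ U ∧ φ a = b) x z := fun h =>
    ReflTransGen.mono (fun a b hab => ⟨hab.1, (hφ hab.1).trans hab.2⟩) _ _ h
  obtain ⟨ψ, hψ, rfl, hl⟩ := exists_zpow_of_reaches hlocφ (key hxz)
  obtain ⟨χ, hχ, hχy, hl'⟩ := exists_zpow_of_reaches hlocφ (key hyz)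
  have hs := hl'.symm
  rw [hχy] at hs
  refine ⟨χ⁻¹ * ψ, mul_mem (inv_mem hχ) hψ, ?_, hs.comp hl⟩
  simp [← hχy]

/-- The homeomorphisms that are locally in `Γ` on a dense set. -/
def genericFullGroup (Γ : Subgroup (S ≃ₜ S)) : Subgroup (S ≃ₜ S) where
  carrier := {ψ | Dense {x | LocallyIn Γ ψ x}}
  one_mem' := dense_univ.mono fun x _ => ⟨1, one_mem _, EventuallyEq.rfl⟩
  mul_mem' {ψ χ} hψ hχ := by
    refine (hχ.inter_of_isOpen_left (hψ.preimage χ.isOpenMap) (isOpen_setOf_locallyIn _)).mono ?_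
    exact fun x hx => LocallyIn.comp (g := ψ) hx.2 hx.1
  inv_mem' {ψ} hψ := by
    refine (ψ.surjective.denseRange.dense_image ψ.continuous hψ).mono ?_
    rintro _ ⟨x, hx, rfl⟩
    exact LocallyIn.symm hx

theorem eventually_fixed_of_relClopen [T2Space S] {D : Set S} (hdense : Dense D) {f : S → S}
    (hf : Continuous f) (h : RelClopen D {z ∈ D | f z = z}) {x : S} (hx : x ∈ D) (hfx : f x = x) :
    ∀ᶠ y in 𝓝 x, f y = y := by
  obtain ⟨N, hN, hNe⟩ := isOpen_induced_iff.1 h.2.isOpen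
  have hNx : x ∈ N := by
    have : (⟨x, hx⟩ : D) ∈ (Subtype.val ⁻¹' N : Set D) := hNe ▸ ⟨hx, hfx⟩
    exact this
  filter_upwards [hN.mem_nhds hNx] with y hy
  have hcl : closure (N ∩ D) ⊆ {z | f z = z} := by
    refine closure_minimal (fun z hz => ?_) (isClosed_eq hf continuous_id)
    have : (⟨z, hz.2⟩ : D) ∈ (Subtype.val ⁻¹' {z ∈ D | f z = z} : Set D) := by
      rw [← hNe]
      exact hz.1
    exact this.2
  exact hcl (hdense.open_subset_closure_inter hN hy)

end Generic

/-- Let `S` be a compact Hausdorff extremally disconnected space with no isolated points,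
`G` a countably infinite group and `ε : G → Homeo(S)` an injective action of `G` on `S` by
homeomorphisms such that for some `s₀ ∈ S` the orbit `D = {ε g s₀ : g ∈ G}` is dense in
`S` and the action is pseudo-free on `D`.  Then there exist a homeomorphism `φ : S → S`
and a dense `Gδ` subset `S₀ ⊆ S` such that: `S₀` is invariant under the action of `G`;
`φ[S₀] = S₀`; and on `S₀` the orbit equivalence relation coming from `G` coincides with
the `ℤ`-orbit equivalence relation coming from `φ`. -/
theorem stmt_14 {S : Type*} [TopologicalSpace S] [CompactSpace S] [T2Space S]
    [ExtremallyDisconnected S] (hiso : ∀ x : S, ¬ IsOpen ({x} : Set S))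
    {G : Type*} [Group G] [Countable G] [Infinite G]
    (ε : G → S ≃ₜ S) (hεone : ε 1 = Homeomorph.refl S)
    (hεmul : ∀ g h : G, ∀ x : S, ε (g * h) x = ε g (ε h x))
    (hεinj : Function.Injective ε)
    (s₀ : S) (D : Set S) (hDdef : D = Set.range fun g : G => ε g s₀)
    (hdense : Dense D)
    (hpf : ∀ g : G, RelClopen D {z ∈ D | ε g z = z}) :
    ∃ (φ : S ≃ₜ S) (S₀ : Set S), IsGδ S₀ ∧ Dense S₀ ∧
      (∀ g : G, (ε g) '' S₀ = S₀) ∧ (φ '' S₀ = S₀) ∧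
      ∀ x ∈ S₀, ∀ y ∈ S₀,
        ((∃ g : G, ε g x = y) ↔ ∃ j : ℤ, (φ.toEquiv ^ j) x = y) := by
  let Γ : Subgroup (S ≃ₜ S) :=
    { carrier := range ε
      one_mem' := ⟨1, hεone⟩
      mul_mem' := by
        rintro _ _ ⟨g, rfl⟩ ⟨h, rfl⟩
        exact ⟨g * h, Homeomorph.ext (hεmul g h)⟩
      inv_mem' := by
        rintro _ ⟨g, rfl⟩
        refine ⟨g⁻¹, eq_inv_of_mul_eq_one_left (Homeomorph.ext fun x => ?_)⟩
        rw [Homeomorph.mul_apply, ← hεmul, inv_mul_cancel, hεone]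
        rfl }
  have hD : ∀ γ ∈ Γ, ∀ x ∈ D, γ x ∈ D := by
    subst hDdef
    rintro _ ⟨g, rfl⟩ _ ⟨h, rfl⟩
    exact ⟨g * h, hεmul g h s₀⟩
  have htrans : ∀ x ∈ D, ∀ y ∈ D, ∃ γ ∈ Γ, γ x = y := by
    subst hDdef
    rintro _ ⟨g, rfl⟩ _ ⟨h, rfl⟩
    refine ⟨ε (h * g⁻¹), ⟨_, rfl⟩, ?_⟩
    simp only [← hεmul, inv_mul_cancel_right]
  obtain ⟨e, he⟩ := exists_surjective_nat G
  obtain ⟨φ, hφ, hφD⟩ := exists_homeomorph_orbit hiso hD htrans hdense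
    (d := fun n => ε (e n) s₀) (by rw [hDdef]; exact he.range_comp fun g => ε g s₀)
  have hpow : ∀ (j : ℤ) (x : S), (φ.toEquiv ^ j) x = (φ ^ j : S ≃ₜ S) x := by
    have h : ∀ n : ℕ, (φ.toEquiv ^ n) = (φ ^ n : S ≃ₜ S).toEquiv := fun n => by
      induction n with
      | zero => rfl
      | succ n ih => rw [pow_succ, pow_succ, ih]; rfl
    intro j x
    obtain ⟨n, rfl | rfl⟩ := j.eq_nat_or_neg
    · rw [zpow_natCast, zpow_natCast, h]
      rfl
    · rw [zpow_neg, zpow_neg, zpow_natCast, zpow_natCast, h]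
      rfl
  let V : ℤ → Set S := fun j => {x | LocallyIn Γ (φ ^ j : S ≃ₜ S) x}
  let W : G → Set S := fun g => ⋃ j : ℤ, interior {x | (φ ^ j : S ≃ₜ S) x = ε g x}
  have hVo : ∀ j, IsOpen (V j) := fun j => isOpen_setOf_locallyIn _
  have hWo : ∀ g, IsOpen (W g) := fun g => isOpen_iUnion fun j => isOpen_interior
  have hVd : ∀ j, Dense (V j) := fun j =>
    (genericFullGroup Γ).zpow_mem (x := φ) (hdense.mono hφ) j
  have hWd : ∀ g, Dense (W g) := by
    refine fun g => hdense.mono fun x hx => ?_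
    obtain ⟨_, ⟨j, rfl⟩, hj, _, ⟨h, rfl⟩, hloc⟩ := hφD x hx (ε g x) (hD _ ⟨g, rfl⟩ x hx)
    refine mem_iUnion.2 ⟨j, mem_interior_iff_mem_nhds.2 ?_⟩
    have hmul : ∀ y, ε h (ε (h⁻¹ * g) y) = ε g y := fun y => by rw [← hεmul, mul_inv_cancel_left]
    have hfix : ε (h⁻¹ * g) x = x := by
      apply (ε h).injective
      rw [hmul, ← hj]
      exact hloc.eq_of_nhds
    filter_upwards [hloc, eventually_fixed_of_relClopen hdense (ε (h⁻¹ * g)).continuous (hpf _) hx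
      hfix] with y hy hy'
    rw [← hmul, hy']
    exact hy
  let S₁ : Set S := (⋂ j, V j) ∩ ⋂ g, W g
  have hS₁ : IsGδ S₁ := (IsGδ.iInter_of_isOpen hVo).inter (IsGδ.iInter_of_isOpen hWo)
  have hS₁d : Dense S₁ := (dense_iInter_of_isOpen hVo hVd).inter_of_Gδ
    (IsGδ.iInter_of_isOpen hVo) (IsGδ.iInter_of_isOpen hWo) (dense_iInter_of_isOpen hWo hWd)
  have hS₁V : ∀ x ∈ S₁, ∀ j : ℤ, ∃ g, (φ ^ j : S ≃ₜ S) x = ε g x := by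
    intro x hx j
    obtain ⟨_, ⟨g, rfl⟩, h⟩ := mem_iInter.1 hx.1 j
    exact ⟨g, h.eq_of_nhds⟩
  have hS₁W : ∀ x ∈ S₁, ∀ g, ∃ j : ℤ, (φ ^ j : S ≃ₜ S) x = ε g x := by
    intro x hx g
    obtain ⟨j, h⟩ := mem_iUnion.1 (mem_iInter.1 hx.2 g)
    have := interior_subset h
    exact ⟨j, this⟩
  let S₀ : Set S := ⋂ g, ε g ⁻¹' S₁
  have hS₀S₁ : S₀ ⊆ S₁ := fun x hx => by simpa [hεone] using mem_iInter.1 hx 1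
  have hinv : ∀ g, MapsTo (ε g) S₀ S₀ := fun g x hx => mem_iInter.2 fun h => by
    simpa only [mem_preimage, ← hεmul] using mem_iInter.1 hx (h * g)
  have hinvφ : ∀ j : ℤ, MapsTo (φ ^ j : S ≃ₜ S) S₀ S₀ := fun j x hx => by
    obtain ⟨g, hg⟩ := hS₁V x (hS₀S₁ hx) j
    exact hg ▸ hinv g hx
  refine ⟨φ, S₀, IsGδ.iInter fun g => hS₁.preimage (ε g).continuous,
    dense_iInter_of_Gδ (fun g => hS₁.preimage (ε g).continuous)
      fun g => hS₁d.preimage (ε g).isOpenMap,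
    fun g => (hinv g).image_subset.antisymm fun x hx => ⟨ε g⁻¹ x, hinv _ hx, ?_⟩,
    (MapsTo.image_subset (by simpa using hinvφ 1)).antisymm
      fun x hx => ⟨φ.symm x, by simpa using hinvφ (-1) hx, φ.apply_symm_apply x⟩,
    fun x hx y _ => ⟨?_, ?_⟩⟩
  · rw [← hεmul, mul_inv_cancel, hεone]
    rfl
  · rintro ⟨g, rfl⟩
    obtain ⟨j, hj⟩ := hS₁W x (hS₀S₁ hx) g
    exact ⟨j, (hpow j x).trans hj⟩
  · rintro ⟨j, rfl⟩
    obtain ⟨g, hg⟩ := hS₁V x (hS₀S₁ hx) j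
    exact ⟨g, hg.symm.trans (hpow j x).symm⟩
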